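/- arXiv:math/0510023 — 3 statements merged into one kernel-verified Lean document; each statement's English description precedes it below -/
import Mathlib

section
/- Let K be a field in which 3 is nonzero (i.e., (3 : K) ≠ 0), let t ∈ K with t ≠ 0, and let α ∈ K satisfy α³ = 27(t − 1)/t = 27(1 − 1/t). Then the Weierstrass curve E in Deuring normal form y² + αxy + y = x³ has discriminant Δ(E) = −27/t, which is nonzero, so that E is an elliptic curve over K, and its j-invariant is j(E) = −27(t − 1)(t − 9)³ / t³. -/
/-- If `3 ≠ 0` in `K`, `t ≠ 0`, and `α³ = 27(t-1)/t`, then the Deuring-form curve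
`y² + αxy + y = x³` has discriminant `-27/t ≠ 0`, hence is an elliptic curve, with
j-invariant `-27(t-1)(t-9)³/t³`. -/
theorem deuring_fiber_discriminant_and_j {K : Type*} [Field K] (h3 : (3 : K) ≠ 0)
    (t : K) (ht : t ≠ 0) (α : K) (hα : α ^ 3 = 27 * (t - 1) / t)
    (E : WeierstrassCurve K)
    (hE : E = { a₁ := α, a₂ := 0, a₃ := 1, a₄ := 0, a₆ := 0 }) :
    E.Δ = -27 / t ∧ E.Δ ≠ 0 ∧
      ∃ h : E.IsElliptic,
        @WeierstrassCurve.j K _ E h = -27 * (t - 1) * (t - 9) ^ 3 / t ^ 3 := by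
  have hΔ_poly : E.Δ = α ^ 3 - 27 := by
    subst hE
    simp only [WeierstrassCurve.Δ, WeierstrassCurve.b₂, WeierstrassCurve.b₄,
      WeierstrassCurve.b₆, WeierstrassCurve.b₈]
    ring
  have hc₄ : E.c₄ ^ 3 = α ^ 3 * (α ^ 3 - 24) ^ 3 := by
    subst hE
    simp only [WeierstrassCurve.c₄, WeierstrassCurve.b₂, WeierstrassCurve.b₄]
    ring
  have h27 : (27 : K) ≠ 0 := by
    rw [show (27 : K) = 3 ^ 3 by norm_num]
    exact pow_ne_zero 3 h3
  have hΔ : E.Δ = -27 / t := by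
    rw [hΔ_poly, hα]
    field_simp
    ring
  have hΔ_ne : E.Δ ≠ 0 := by
    rw [hΔ]
    exact div_ne_zero (neg_ne_zero.mpr h27) ht
  have hE_ell : E.IsElliptic := ⟨hΔ_ne.isUnit⟩
  refine ⟨hΔ, hΔ_ne, hE_ell, ?_⟩
  rw [WeierstrassCurve.j, Units.val_inv_eq_inv_val, WeierstrassCurve.coe_Δ',
    inv_mul_eq_iff_eq_mul₀ hΔ_ne, hΔ, hc₄, hα]
  field_simp
  ring
end

section
/- Let K be an algebraically closed field of characteristic zero, let q ∈ Kˣ be an element of the multiplicative group of K that is not of finite order (i.e., not a root of unity), and let m be a positive integer. Then the m-torsion subgroup of the quotient group A = Kˣ / ⟨q⟩ (where ⟨q⟩ denotes the subgroup generated by q), namely {a ∈ A : aᵐ = 1}, is isomorphic as a group to (ℤ/mℤ) × (ℤ/mℤ). -/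
/-- In a commutative group whose `m`-torsion is generated by an element `ζ` of order `m`, the
`m`-torsion of the quotient by an element `r ^ m` of infinite order is `(ℤ/mℤ)²`, generated by
the classes of `ζ` and `r`. -/
theorem nonempty_ker_powMonoidHom_quotient_zpowers_mulEquiv {G : Type*} [CommGroup G]
    {q r ζ : G} {m : ℕ} (hq : ¬ IsOfFinOrder q) (hr : r ^ m = q) (hζ : IsPrimitiveRoot ζ m)
    (hroots : ∀ x : G, x ^ m = 1 → x ∈ Subgroup.zpowers ζ) :
    Nonempty ((MonoidHom.ker (powMonoidHom (α := G ⧸ Subgroup.zpowers q) m)) ≃*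
      Multiplicative (ZMod m × ZMod m)) := by
  have hqinj : Function.Injective fun n : ℤ => q ^ n :=
    injective_zpow_iff_not_isOfFinOrder.2 hq
  let T := MonoidHom.ker (powMonoidHom (α := G ⧸ Subgroup.zpowers q) m)
  let z : T := ⟨(ζ : G ⧸ Subgroup.zpowers q), by
    rw [MonoidHom.mem_ker, powMonoidHom_apply, ← QuotientGroup.mk_pow, hζ.pow_eq_one,
      QuotientGroup.mk_one]⟩
  let s : T := ⟨(r : G ⧸ Subgroup.zpowers q), by
    rw [MonoidHom.mem_ker, powMonoidHom_apply, ← QuotientGroup.mk_pow, hr,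
      QuotientGroup.eq_one_iff]
    exact Subgroup.mem_zpowers q⟩
  have hT (t : T) : t ^ m = 1 := Subtype.ext t.2
  let lift (t : T) : ZMod m →+ Additive T :=
    ZMod.lift m ⟨zmultiplesHom (Additive T) (Additive.ofMul t), by
      rw [zmultiplesHom_apply, natCast_zsmul, ← ofMul_pow, hT, ofMul_one]⟩
  let f : ZMod m × ZMod m →+ Additive T := (lift z).coprod (lift s)
  have hf (a b : ℤ) : ((f (a, b)).toMul : G ⧸ Subgroup.zpowers q) = ((ζ ^ a * r ^ b : G) :) := by
    simp [f, lift, z, s]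
  have hinj : Function.Injective f := by
    rw [injective_iff_map_eq_zero]
    rintro ⟨a, b⟩ h
    obtain ⟨a, rfl⟩ := ZMod.intCast_surjective a
    obtain ⟨b, rfl⟩ := ZMod.intCast_surjective b
    have h1 := hf a b
    rw [h, toMul_zero, OneMemClass.coe_one, eq_comm, QuotientGroup.eq_one_iff] at h1
    obtain ⟨k, hk : q ^ k = ζ ^ a * r ^ b⟩ := h1
    have hb : (m : ℤ) * k = b := by
      apply hqinj
      calc q ^ ((m : ℤ) * k) = (q ^ k) ^ m := by rw [mul_comm, zpow_mul, zpow_natCast]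
        _ = (ζ ^ m) ^ a * (r ^ m) ^ b := by
          rw [hk, mul_pow, ← zpow_natCast, ← zpow_natCast, zpow_comm ζ, zpow_comm r,
            zpow_natCast, zpow_natCast]
        _ = q ^ b := by rw [hζ.pow_eq_one, hr, one_zpow, one_mul]
    have ha : ζ ^ a = 1 := by
      rwa [← hb, zpow_mul, zpow_natCast, hr, right_eq_mul] at hk
    rw [Prod.mk_eq_zero, ZMod.intCast_zmod_eq_zero_iff_dvd, ZMod.intCast_zmod_eq_zero_iff_dvd]
    exact ⟨(hζ.zpow_eq_one_iff_dvd a).1 ha, k, hb.symm⟩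
  have hsurj : Function.Surjective f := by
    intro t
    obtain ⟨x, hx⟩ := QuotientGroup.mk_surjective (t.toMul : G ⧸ Subgroup.zpowers q)
    have hxm : (x : G ⧸ Subgroup.zpowers q) ^ m = 1 := hx ▸ t.toMul.2
    rw [← QuotientGroup.mk_pow, QuotientGroup.eq_one_iff] at hxm
    obtain ⟨k, hk : q ^ k = x ^ m⟩ := hxm
    obtain ⟨a, ha : ζ ^ a = x / r ^ k⟩ := hroots (x / r ^ k) <| by
      rw [div_pow, ← hk, ← hr, ← zpow_natCast, ← zpow_natCast, zpow_comm, div_self']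
    refine ⟨(a, k), Additive.toMul.injective (Subtype.ext ?_)⟩
    rw [hf, ha, div_mul_cancel, hx]
  exact ⟨(AddEquiv.toMultiplicativeLeft (AddEquiv.ofBijective f ⟨hinj, hsurj⟩)).symm⟩

/-- For `K` algebraically closed of characteristic zero and `q ∈ Kˣ` not a root of
unity, the `m`-torsion subgroup of `A = Kˣ/⟨q⟩` is isomorphic to `(ℤ/mℤ)²`. -/
theorem tate_parametrization_torsion {K : Type*} [Field K] [IsAlgClosed K]
    [CharZero K] (q : Kˣ) (hq : ¬ IsOfFinOrder q) (m : ℕ) (hm : 0 < m) :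
    Nonempty
      ((MonoidHom.ker (powMonoidHom (α := Kˣ ⧸ Subgroup.zpowers q) m))
        ≃* Multiplicative (ZMod m × ZMod m)) := by
  have : NeZero m := ⟨hm.ne'⟩
  obtain ⟨r, hr⟩ := IsAlgClosed.exists_pow_nat_eq (q : K) hm
  obtain ⟨ζ, hζ⟩ := HasEnoughRootsOfUnity.exists_primitiveRoot K m
  have hr0 : r ≠ 0 := by
    rintro rfl
    exact q.ne_zero (by rw [← hr, zero_pow hm.ne'])
  have hζu : IsPrimitiveRoot (hζ.isUnit hm.ne').unit m := hζ.isUnit_unit hm.ne'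
  refine nonempty_ker_powMonoidHom_quotient_zpowers_mulEquiv (r := Units.mk0 r hr0) hq
    (Units.ext hr) hζu fun x hx => ?_
  rwa [hζu.zpowers_eq, mem_rootsOfUnity]
end

section
/- Let K be a field of characteristic different from 2, let t ∈ K with t ≠ 0, let s ∈ K satisfy s² = 1 − t⁴, and set λ = (1 + s)/2. Then λ ≠ 0 and λ ≠ 1, the Weierstrass curve E_t : y² = x(x − 1)(x − λ) (i.e., y² = x³ − (1 + λ)x² + λx) has discriminant Δ(E_t) = 16 λ²(1 − λ)² = t⁸, which is nonzero, so E_t is an elliptic curve over K, and its j-invariant is j(E_t) = 256(λ² − λ + 1)³ / (λ(1 − λ))² = 64(4 − t⁴)³ / t⁸. -/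
/-- Over a field the j-invariant of an elliptic curve is `c₄³ / Δ`. -/
theorem WeierstrassCurve.j_eq_c₄_pow_div_Δ {K : Type*} [Field K] (E : WeierstrassCurve K)
    [E.IsElliptic] : E.j = E.c₄ ^ 3 / E.Δ := by
  rw [WeierstrassCurve.j, Units.val_inv_eq_inv_val, WeierstrassCurve.coe_Δ', div_eq_inv_mul]

/-- For `char K ≠ 2`, `t ≠ 0`, `s² = 1 - t⁴`, and `λ = (1+s)/2`, the Legendre-form
curve `y² = x(x-1)(x-λ)` has discriminant `16λ²(1-λ)² = t⁸ ≠ 0`, hence is an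
elliptic curve, with j-invariant `256(λ²-λ+1)³/(λ(1-λ))² = 64(4-t⁴)³/t⁸`. -/
theorem legendre_curve_discriminant_and_j {K : Type*} [Field K] (h2 : (2 : K) ≠ 0)
    (t : K) (ht : t ≠ 0) (s : K) (hs : s ^ 2 = 1 - t ^ 4)
    (lam : K) (hlam : lam = (1 + s) / 2)
    (E : WeierstrassCurve K)
    (hE : E = { a₁ := 0, a₂ := -(1 + lam), a₃ := 0, a₄ := lam, a₆ := 0 }) :
    lam ≠ 0 ∧ lam ≠ 1 ∧
      E.Δ = 16 * lam ^ 2 * (1 - lam) ^ 2 ∧ E.Δ = t ^ 8 ∧ E.Δ ≠ 0 ∧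
      ∃ h : E.IsElliptic,
        @WeierstrassCurve.j K _ E h = 256 * (lam ^ 2 - lam + 1) ^ 3 / (lam * (1 - lam)) ^ 2 ∧
        @WeierstrassCurve.j K _ E h = 64 * (4 - t ^ 4) ^ 3 / t ^ 8 := by
  have key : 4 * (lam * (1 - lam)) = t ^ 4 := by
    have hs' : 2 * lam = 1 + s := by rw [hlam, mul_div_cancel₀ _ h2]
    linear_combination (1 - 2 * lam - s) * hs' - hs
  have hprod : lam * (1 - lam) ≠ 0 := fun h => pow_ne_zero 4 ht (by rw [← key, h, mul_zero])
  have hlam0 : lam ≠ 0 := left_ne_zero_of_mul hprod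
  have hlam1 : 1 - lam ≠ 0 := right_ne_zero_of_mul hprod
  have hΔ : E.Δ = 16 * lam ^ 2 * (1 - lam) ^ 2 := by
    subst hE
    simp only [WeierstrassCurve.Δ, WeierstrassCurve.b₂, WeierstrassCurve.b₄,
      WeierstrassCurve.b₆, WeierstrassCurve.b₈]
    ring
  have hc₄ : E.c₄ = 16 * (lam ^ 2 - lam + 1) := by
    subst hE
    simp only [WeierstrassCurve.c₄, WeierstrassCurve.b₂, WeierstrassCurve.b₄]
    ring
  have hΔt : E.Δ = t ^ 8 := by
    linear_combination hΔ + (4 * (lam * (1 - lam)) + t ^ 4) * key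
  have hΔ0 : E.Δ ≠ 0 := hΔt ▸ pow_ne_zero 8 ht
  have hE' : E.IsElliptic := ⟨hΔ0.isUnit⟩
  refine ⟨hlam0, (sub_ne_zero.mp hlam1).symm, hΔ, hΔt, hΔ0, hE', ?_, ?_⟩
  · rw [E.j_eq_c₄_pow_div_Δ, div_eq_div_iff hΔ0 (pow_ne_zero 2 hprod), hc₄, hΔ]
    ring
  · rw [E.j_eq_c₄_pow_div_Δ, hΔt, hc₄, ← key]
    ring
end
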